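/- Let N be a network on n nodes with γ protocols, and let S, D be nodes. If there exists a feasible path from S to D, then there exists a feasible path from S to D whose maximum stack height is at most γ·n². -/

import Mathlib

/-- An adaptation function over a protocol set `A`: a conversion `(a→b)`,
an encapsulation `(a→ab)`, or a decapsulation `(a→ab)‾`. -/
inductive AdaptFun (A : Type) where
  | conv : A → A → AdaptFun A
  | encap : A → A → AdaptFun A
  | decap : A → A → AdaptFun A
deriving DecidableEq

/-- The partial action of an adaptation function on a protocol stack
(a list whose head is the top of the stack). -/
def AdaptFun.apply {A : Type} [DecidableEq A] : AdaptFun A → List A → Option (List A)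
  | .conv a b, x :: T => if x = a then some (b :: T) else none
  | .encap a b, x :: T => if x = a then some (b :: a :: T) else none
  | .decap a b, y :: x :: T => if y = b ∧ x = a then some (a :: T) else none
  | _, _ => none

/-- A network (without cost function): a symmetric directed graph on node set `V`,
adaptation functions `F U` available at each node, and receivable protocols `In U`. -/
structure Network (A V : Type) where
  E : V → V → Prop
  symm : ∀ u v, E u v ↔ E v u
  F : V → Set (AdaptFun A)
  In : V → Set A

/-- A path `S f₀ U₁ f₁ … U_ℓ f_ℓ D`: `len` is `ℓ`, `nodes i` is `U_i`
(with `nodes 0 = S` and `nodes (ℓ+1) = D`), and `funs i` is `f_i`. -/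
structure NetPath (A V : Type) where
  len : ℕ
  nodes : ℕ → V
  funs : ℕ → AdaptFun A

/-- The stack sequence of a path: `H₀ = [x]` where `f₀` is the conversion `(x→x)`,
and `H_i = f_i (H_{i-1})`. -/
def NetPath.stack {A V : Type} [DecidableEq A] (P : NetPath A V) : ℕ → Option (List A)
  | 0 =>
    match P.funs 0 with
    | .conv a b => if a = b then some [a] else none
    | _ => none
  | i + 1 => (P.stack i).bind (P.funs (i + 1)).apply

/-- Feasibility of a path from `S` to `D` in the network `N`. -/
def Feasible {A V : Type} [DecidableEq A] (N : Network A V) (S D : V)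
    (P : NetPath A V) : Prop :=
  P.nodes 0 = S ∧ P.nodes (P.len + 1) = D ∧
  (∀ i ≤ P.len, N.E (P.nodes i) (P.nodes (i + 1))) ∧
  (∀ i, 1 ≤ i → i ≤ P.len → P.funs i ∈ N.F (P.nodes i)) ∧
  (∃ x, P.funs 0 = .conv x x) ∧
  (∀ i ≤ P.len, (P.stack i).isSome) ∧
  (∃ y ∈ N.In D, P.stack P.len = some [y])

/-- The maximum stack height `max_i |H_i|` reached along a path. -/
def NetPath.maxHeight {A V : Type} [DecidableEq A] (P : NetPath A V) : ℕ :=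
  (Finset.range (P.len + 1)).sup fun i => ((P.stack i).map List.length).getD 0

open Relation

namespace Network

variable {A V : Type} (N : Network A V)

/-- One move of the network on configurations (current node, current stack). -/
def Step [DecidableEq A] (c d : V × List A) : Prop :=
  N.E c.1 d.1 ∧ ∃ f ∈ N.F c.1, f.apply c.2 = some d.2

/-- A move whose resulting stack has height at most `h`. -/
def BoundedStep [DecidableEq A] (h : ℕ) (c d : V × List A) : Prop :=
  N.Step c d ∧ d.2.length ≤ h

/-- Moves of the top protocol, where a triple `(u, v, a)` of `R` is a shortcut from `u` to `v`
that leaves the top protocol `a` as it is. -/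
def TopStep (R : Set (V × V × A)) (c d : V × A) : Prop :=
  (N.E c.1 d.1 ∧ .conv c.2 d.2 ∈ N.F c.1) ∨ (c.2 = d.2 ∧ (c.1, d.1, c.2) ∈ R)

/-- The triples `(u, v, a)` such that `u = v` or one gets from `u` to `v` by an encapsulation
over `a`, moves of the new top protocol with shortcuts in `R`, and a decapsulation. -/
def excursions (R : Set (V × V × A)) : Set (V × V × A) :=
  {t | t.1 = t.2.1 ∨ ∃ u v b c, N.E t.1 u ∧ .encap t.2.2 b ∈ N.F t.1 ∧
    ReflTransGen (N.TopStep R) (u, b) (v, c) ∧ N.E v t.2.1 ∧ .decap t.2.2 c ∈ N.F v}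

/-- The shortcuts that raise the stack by at most `k`. -/
def shortcuts : ℕ → Set (V × V × A)
  | 0 => {t | t.1 = t.2.1}
  | k + 1 => N.excursions (shortcuts k)

variable {N}

theorem TopStep.mono {R R' : Set (V × V × A)} (h : R ⊆ R') {c d : V × A}
    (hs : N.TopStep R c d) : N.TopStep R' c d :=
  hs.imp_right fun hs => ⟨hs.1, h hs.2⟩

variable (N)

theorem excursions_mono : Monotone N.excursions := by
  rintro R R' h t (ht | ⟨u, v, b, c, h₁, h₂, h₃, h₄⟩)
  · exact .inl ht
  · exact .inr ⟨u, v, b, c, h₁, h₂, ReflTransGen.mono (fun _ _ => TopStep.mono h) _ _ h₃, h₄⟩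

theorem shortcuts_mono : Monotone N.shortcuts := by
  refine monotone_nat_of_le_succ fun k => ?_
  induction k with
  | zero => exact fun t ht => .inl ht
  | succ k ih => exact N.excursions_mono ih

theorem shortcuts_succ_eq [Fintype A] [Fintype V] [Nonempty A] [Nonempty V] :
    N.shortcuts (Fintype.card A * Fintype.card V ^ 2 - 1 + 1) =
      N.shortcuts (Fintype.card A * Fintype.card V ^ 2 - 1) := by
  have hpos (k : ℕ) : 0 < (N.shortcuts k).ncard := by
    rw [Set.ncard_pos (Set.toFinite _)]
    exact ⟨(Classical.arbitrary V, Classical.arbitrary V, Classical.arbitrary A),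
      N.shortcuts_mono (Nat.zero_le k) rfl⟩
  have heq (k l : ℕ) (hkl : k ≤ l)
      (h : (N.shortcuts k).ncard - 1 = (N.shortcuts l).ncard - 1) :
      N.shortcuts k = N.shortcuts l :=
    Set.eq_of_subset_of_ncard_le (N.shortcuts_mono hkl)
      (by have := hpos k; have := hpos l; omega) (Set.toFinite _)
  refine (heq _ _ (Nat.le_succ _) (Eq.symm ?_)).symm
  refine Nat.stabilises_of_monotone (f := fun k => (N.shortcuts k).ncard - 1)
    (fun k l hkl => Nat.sub_le_sub_right
      (Set.ncard_le_ncard (N.shortcuts_mono hkl) (Set.toFinite _)) 1) (fun k => ?_) (fun k h => ?_)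
    (Nat.le_succ _)
  · refine Nat.sub_le_sub_right ((Set.ncard_le_card _).trans_eq ?_) 1
    rw [Nat.card_eq_fintype_card, Fintype.card_prod, Fintype.card_prod]
    ring
  · have := heq _ _ (Nat.le_succ k) h
    change (N.excursions (N.shortcuts k)).ncard - 1 =
      (N.excursions (N.shortcuts (k + 1))).ncard - 1
    rw [← this]

/-- The stack of a configuration can be built from the single protocol of `c` one level at a time,
using moves of the top protocol with shortcuts in `R`. -/
def Built (R : Set (V × V × A)) (c : V × A) : V → List A → Prop
  | _, [] => False
  | v, [b] => ReflTransGen (N.TopStep R) c (v, b)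
  | v, b :: a :: T => ∃ w u e, Built R c w (a :: T) ∧ N.E w u ∧ .encap a e ∈ N.F w ∧
      ReflTransGen (N.TopStep R) (u, e) (v, b)

variable {N}

theorem Built.trans {R : Set (V × V × A)} {c : V × A} {v w : V} {a b : A} {T : List A}
    (h : N.Built R c v (a :: T)) (hs : ReflTransGen (N.TopStep R) (v, a) (w, b)) :
    N.Built R c w (b :: T) := by
  cases T with
  | nil => exact ReflTransGen.trans h hs
  | cons x T =>
    obtain ⟨w', u, e, h₁, h₂, h₃, h₄⟩ := h
    exact ⟨w', u, e, h₁, h₂, h₃, h₄.trans hs⟩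

variable [DecidableEq A]

theorem BoundedStep.mono {h h' : ℕ} (hh : h ≤ h') {c d : V × List A}
    (hs : N.BoundedStep h c d) : N.BoundedStep h' c d :=
  ⟨hs.1, hs.2.trans hh⟩

theorem reflTransGen_boundedStep_of_topStep_of_shortcut {R : Set (V × V × A)} {h : ℕ} {T : List A}
    (hT : T.length < h)
    (hR : ∀ u v a, (u, v, a) ∈ R → ReflTransGen (N.BoundedStep h) (u, a :: T) (v, a :: T))
    {c d : V × A} (hcd : ReflTransGen (N.TopStep R) c d) :
    ReflTransGen (N.BoundedStep h) (c.1, c.2 :: T) (d.1, d.2 :: T) := by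
  induction hcd with
  | refl => exact .refl
  | @tail d e _ hs ih =>
    obtain ⟨hE, hF⟩ | ⟨ha, ht⟩ := hs
    · exact ih.tail ⟨⟨hE, _, hF, by simp [AdaptFun.apply]⟩, by simpa using hT⟩
    · rw [← ha]
      exact ih.trans (hR _ _ _ ht)

theorem reflTransGen_boundedStep_of_mem_shortcuts (k : ℕ) {u v : V} {a : A}
    (h : (u, v, a) ∈ N.shortcuts k) (T : List A) :
    ReflTransGen (N.BoundedStep (T.length + k + 1)) (u, a :: T) (v, a :: T) := by
  induction k generalizing u v a T with
  | zero =>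
    obtain rfl : u = v := h
    exact .refl
  | succ k ih =>
    obtain h | ⟨u', v', b, c, hE, hF, hrun, hE', hF'⟩ := h
    · obtain rfl : u = v := h
      exact .refl
    · have hrun' := reflTransGen_boundedStep_of_topStep_of_shortcut
        (T := a :: T) (h := T.length + (k + 1) + 1) (by grind)
        (fun u v b hb => ReflTransGen.mono (fun _ _ => BoundedStep.mono (by grind)) _ _
          (ih hb (a :: T))) hrun
      refine ReflTransGen.head ?_ (hrun'.tail ?_)
      · exact ⟨⟨hE, _, hF, by simp [AdaptFun.apply]⟩, by simp⟩
      · exact ⟨⟨hE', _, hF', by simp [AdaptFun.apply]⟩, by simp⟩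

theorem reflTransGen_boundedStep_of_topStep {k : ℕ} {c d : V × A}
    (hcd : ReflTransGen (N.TopStep (N.shortcuts k)) c d) :
    ReflTransGen (N.BoundedStep (k + 1)) (c.1, [c.2]) (d.1, [d.2]) :=
  reflTransGen_boundedStep_of_topStep_of_shortcut (by simp)
    (fun u v a h => by simpa using reflTransGen_boundedStep_of_mem_shortcuts k h []) hcd

theorem Built.step {R : Set (V × V × A)} (hR : N.excursions R ⊆ R) {c : V × A} {d e : V × List A}
    (h : N.Built R c d.1 d.2) (hs : N.Step d e) : N.Built R c e.1 e.2 := by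
  obtain ⟨v, H⟩ := d
  obtain ⟨w, K⟩ := e
  obtain ⟨hE, f, hf, hfa⟩ := hs
  dsimp only at *
  rcases f with ⟨a, b⟩ | ⟨a, b⟩ | ⟨a, b⟩
  · rcases H with _ | ⟨x, T⟩ <;> simp [AdaptFun.apply] at hfa
    obtain ⟨rfl, rfl⟩ := hfa
    exact h.trans (.single (.inl ⟨hE, hf⟩))
  · rcases H with _ | ⟨x, T⟩ <;> simp [AdaptFun.apply] at hfa
    obtain ⟨rfl, rfl⟩ := hfa
    exact ⟨v, w, b, h, hE, hf, .refl⟩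
  · rcases H with _ | ⟨y, _ | ⟨x, T⟩⟩ <;> simp [AdaptFun.apply] at hfa
    obtain ⟨⟨rfl, rfl⟩, rfl⟩ := hfa
    obtain ⟨w', u, e, h₁, h₂, h₃, h₄⟩ := h
    exact h₁.trans (.single (.inr ⟨rfl, hR (.inr ⟨u, v, e, y, h₂, h₃, h₄, hE, hf⟩)⟩))

theorem reflTransGen_topStep_of_step {R : Set (V × V × A)} (hR : N.excursions R ⊆ R) {c d : V × A}
    (h : ReflTransGen N.Step (c.1, [c.2]) (d.1, [d.2])) :
    ReflTransGen (N.TopStep R) c d := by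
  have key (e : V × List A) (he : ReflTransGen N.Step (c.1, [c.2]) e) : N.Built R c e.1 e.2 := by
    induction he with
    | refl => exact ReflTransGen.refl
    | tail _ hs ih => exact ih.step hR hs
  exact key _ h

theorem reflTransGen_boundedStep_of_step [Fintype A] [Fintype V] {c d : V × A}
    (h : ReflTransGen N.Step (c.1, [c.2]) (d.1, [d.2])) :
    ReflTransGen (N.BoundedStep (Fintype.card A * Fintype.card V ^ 2)) (c.1, [c.2])
      (d.1, [d.2]) := by
  have : Nonempty A := ⟨c.2⟩
  have : Nonempty V := ⟨c.1⟩
  have hpos : 0 < Fintype.card A * Fintype.card V ^ 2 := by positivity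
  have := reflTransGen_boundedStep_of_topStep
    (reflTransGen_topStep_of_step (R := N.shortcuts (_ - 1)) N.shortcuts_succ_eq.subset h)
  rwa [Nat.sub_add_cancel hpos] at this

end Network

namespace NetPath

variable {A V : Type} [DecidableEq A]

theorem stack_congr {P Q : NetPath A V} {i : ℕ} (h : ∀ j ≤ i, P.funs j = Q.funs j) :
    P.stack i = Q.stack i := by
  induction i with
  | zero => simp only [stack, h 0 le_rfl]
  | succ i ih => simp only [stack, h (i + 1) le_rfl, ih fun j hj => h j (hj.trans i.le_succ)]

theorem stack_zero {P : NetPath A V} {x : A} (h : P.funs 0 = .conv x x) :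
    P.stack 0 = some [x] := by
  simp [stack, h]

end NetPath

theorem Feasible.reflTransGen_step {A V : Type} [DecidableEq A] {N : Network A V} {S D : V}
    {P : NetPath A V} (h : Feasible N S D P) :
    ∃ u x, ∃ y ∈ N.In D, N.E S u ∧ ReflTransGen N.Step (u, [x]) (D, [y]) := by
  obtain ⟨rfl, rfl, hE, hF, ⟨x, hx⟩, hsome, y, hy, hlast⟩ := h
  refine ⟨P.nodes 1, x, y, hy, hE 0 (Nat.zero_le _), ?_⟩
  have key (i : ℕ) (hi : i ≤ P.len) (H : List A) (hH : P.stack i = some H) :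
      ReflTransGen N.Step (P.nodes 1, [x]) (P.nodes (i + 1), H) := by
    induction i generalizing H with
    | zero =>
      obtain rfl : [x] = H := by simpa [NetPath.stack_zero hx] using hH
      exact .refl
    | succ i ih =>
      obtain ⟨K, hK, hKH⟩ := Option.bind_eq_some_iff.1 hH
      exact (ih (Nat.le_of_succ_le hi) K hK).tail
        ⟨hE _ hi, _, hF _ (Nat.succ_pos i) hi, hKH⟩
  exact key _ le_rfl _ hlast

theorem Network.exists_netPath_of_reflTransGen_boundedStep {A V : Type} [DecidableEq A]
    {N : Network A V} {S u : V} {x : A} {h : ℕ} (hh : 0 < h) (hu : N.E S u) {c : V × List A}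
    (hc : ReflTransGen (N.BoundedStep h) (u, [x]) c) :
    ∃ P : NetPath A V, P.nodes 0 = S ∧ P.nodes (P.len + 1) = c.1 ∧
      (∀ i ≤ P.len, N.E (P.nodes i) (P.nodes (i + 1))) ∧
      (∀ i, 1 ≤ i → i ≤ P.len → P.funs i ∈ N.F (P.nodes i)) ∧
      P.funs 0 = .conv x x ∧
      (∀ i ≤ P.len, ∃ H, P.stack i = some H ∧ H.length ≤ h) ∧
      P.stack P.len = some c.2 := by
  induction hc with
  | refl =>
    refine ⟨⟨0, fun i => if i = 0 then S else u, fun _ => .conv x x⟩, rfl, rfl, ?_, ?_, rfl, ?_,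
      NetPath.stack_zero rfl⟩
    · rintro i hi
      obtain rfl : i = 0 := by simpa using hi
      simpa using hu
    · intro i hi hi'
      exact absurd (hi.trans hi') (by simp)
    · intro i hi
      obtain rfl : i = 0 := by simpa using hi
      exact ⟨[x], NetPath.stack_zero rfl, hh⟩
  | @tail c d _ hs ih =>
    obtain ⟨P, hS, hD, hE, hF, hx, hst, hlast⟩ := ih
    obtain ⟨⟨hcd, f, hf, hfa⟩, hlen⟩ := hs
    let Q : NetPath A V := ⟨P.len + 1, fun i => if i ≤ P.len + 1 then P.nodes i else d.1,
      fun i => if i ≤ P.len then P.funs i else f⟩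
    have hn (i : ℕ) (hi : i ≤ P.len + 1) : Q.nodes i = P.nodes i := if_pos hi
    have hn' : Q.nodes (P.len + 2) = d.1 := if_neg (by omega)
    have hfu (i : ℕ) (hi : i ≤ P.len) : Q.funs i = P.funs i := if_pos hi
    have hfu' : Q.funs (P.len + 1) = f := if_neg (by omega)
    have hstack (i : ℕ) (hi : i ≤ P.len) : Q.stack i = P.stack i :=
      NetPath.stack_congr fun j hj => hfu j (hj.trans hi)
    have hQlast : Q.stack (P.len + 1) = some d.2 := by
      rw [NetPath.stack, hstack _ le_rfl, hlast, hfu']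
      exact hfa
    refine ⟨Q, (hn 0 (Nat.zero_le _)).trans hS, hn', fun i hi => ?_, fun i hi hi' => ?_,
      (hfu 0 (Nat.zero_le _)).trans hx, fun i hi => ?_, hQlast⟩
    · obtain hi | rfl := Nat.le_succ_iff.1 hi
      · rw [hn i (by omega), hn (i + 1) (by omega)]
        exact hE i hi
      · rw [hn _ le_rfl, hn', hD]
        exact hcd
    · obtain hi' | rfl := Nat.le_succ_iff.1 hi'
      · rw [hn i (by omega), hfu i hi']
        exact hF i hi hi'
      · rw [hn _ le_rfl, hfu', hD]
        exact hf
    · obtain hi | rfl := Nat.le_succ_iff.1 hi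
      · rw [hstack i hi]
        exact hst i hi
      · exact ⟨_, hQlast, hlen⟩

/-- If there exists a feasible path from `S` to `D`, then there exists one whose
maximum stack height is at most `γ·n²`. -/
theorem exists_feasible_path_maxHeight_le
    {A V : Type} [DecidableEq A] [Fintype A] [Fintype V]
    (γ n : ℕ) (hγ : Fintype.card A = γ) (hn : Fintype.card V = n)
    (N : Network A V) (S D : V)
    (hex : ∃ P : NetPath A V, Feasible N S D P) :
    ∃ P : NetPath A V, Feasible N S D P ∧ P.maxHeight ≤ γ * n ^ 2 := by
  obtain ⟨P, hP⟩ := hex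
  obtain ⟨u, x, y, hy, hu, hreach⟩ := hP.reflTransGen_step
  have hb := Network.reflTransGen_boundedStep_of_step (c := (u, x)) (d := (D, y)) hreach
  rw [hγ, hn] at hb
  have : Nonempty A := ⟨x⟩
  have : Nonempty V := ⟨u⟩
  have hpos : 0 < γ * n ^ 2 := by
    rw [← hγ, ← hn]
    positivity
  obtain ⟨Q, hS, hD, hE, hF, hx, hst, hlast⟩ :=
    Network.exists_netPath_of_reflTransGen_boundedStep hpos hu hb
  refine ⟨Q, ⟨hS, hD, hE, hF, ⟨x, hx⟩, fun i hi => ?_, y, hy, hlast⟩, Finset.sup_le fun i hi => ?_⟩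
  · obtain ⟨H, hH, -⟩ := hst i hi
    simp [hH]
  · obtain ⟨H, hH, hle⟩ := hst i (Nat.lt_succ_iff.1 (Finset.mem_range.1 hi))
    simpa [hH] using hle
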